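/- arXiv:1809.08299 — 2 statements merged into one kernel-verified Lean document; each statement's English description precedes it below -/
import Mathlib

section
/- Model-wise quantifier elimination for DLO over B + K: let M=⟨W,R,D,*,s,V⟩ be any B-model over the signature of DLO satisfying the K condition whose designated world s satisfies all axioms of DLO, and let A(x̄) be any formula. Then there is a quantifier-free formula B(x̄) such that for every sequence ā of elements of D: M,s ⊨ A[ā] if and only if M,s ⊨ B[ā]. In particular, every set definable at s in M is definable at s by a quantifier-free formula. -/
namespace RM

/-- A first-order signature: function symbols with arities and
relation symbols with arities. -/
structure Signature where
  Func : Type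
  farity : Func → ℕ
  Rel : Type
  rarity : Rel → ℕ

variable {σ : Signature}

/-- Terms over a signature, with variables indexed by `ℕ`. -/
inductive Term (σ : Signature) : Type where
  | var : ℕ → Term σ
  | func : (f : σ.Func) → (Fin (σ.farity f) → Term σ) → Term σ

/-- Formulas of the quantificational relevant language:
`⊥`, `⊤`, (logical) equality, atomic relations, `∧`, `∨`, `¬`, `→`, `∀`, `∃`. -/
inductive Formula (σ : Signature) : Type where
  | falsum : Formula σ
  | verum : Formula σ
  | equal : Term σ → Term σ → Formula σ
  | rel : (r : σ.Rel) → (Fin (σ.rarity r) → Term σ) → Formula σ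
  | and : Formula σ → Formula σ → Formula σ
  | or : Formula σ → Formula σ → Formula σ
  | neg : Formula σ → Formula σ
  | imp : Formula σ → Formula σ → Formula σ
  | all : ℕ → Formula σ → Formula σ
  | ex : ℕ → Formula σ → Formula σ

/-- The relevant biconditional `A ↔ B := (A → B) ∧ (B → A)`. -/
def Formula.iff (A B : Formula σ) : Formula σ := .and (.imp A B) (.imp B A)

/-- Free variables of a term. -/
def Term.fv : Term σ → Set ℕ
  | .var n => {n}
  | .func _ ts => ⋃ i, (ts i).fv

/-- Free variables of a formula. -/
def Formula.fv : Formula σ → Set ℕ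
  | .falsum => ∅
  | .verum => ∅
  | .equal t u => t.fv ∪ u.fv
  | .rel _ ts => ⋃ i, (ts i).fv
  | .and A B => A.fv ∪ B.fv
  | .or A B => A.fv ∪ B.fv
  | .imp A B => A.fv ∪ B.fv
  | .neg A => A.fv
  | .all x A => A.fv \ {x}
  | .ex x A => A.fv \ {x}

/-- Quantifier-free formulas. -/
def Formula.QFree : Formula σ → Prop
  | .falsum => True
  | .verum => True
  | .equal _ _ => True
  | .rel _ _ => True
  | .and A B => A.QFree ∧ B.QFree
  | .or A B => A.QFree ∧ B.QFree
  | .imp A B => A.QFree ∧ B.QFree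
  | .neg A => A.QFree
  | .all _ _ => False
  | .ex _ _ => False

/-- A sentence is a formula with no free variables. -/
def Formula.Sentence (A : Formula σ) : Prop := A.fv = ∅

/-- A `B`-model (Routley–Meyer model for the basic relevant logic **B**):
worlds `W`, ternary relation `R`, domain `D`, Routley star `*`,
designated world `s`, world-independent interpretation of function symbols,
world-relative valuation `V` of relation symbols, subject to the usual
conditions; the logical equality symbol is always interpreted as real identity. -/
structure BModel (σ : Signature) where
  W : Type
  R : W → W → W → Prop
  D : Type
  dne : Nonempty D
  star : W → W
  s : W
  interpFunc : (f : σ.Func) → (Fin (σ.farity f) → D) → D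
  V : W → (r : σ.Rel) → (Fin (σ.rarity r) → D) → Prop
  base : ∀ α, R s α α
  btrans : ∀ α β γ δ, R s α β → R β γ δ → R α γ δ
  star_star : ∀ α, star (star α) = α
  star_anti : ∀ α β, R s α β → R s (star β) (star α)
  hered : ∀ α β, R s α β → ∀ r v, V α r v → V β r v

namespace BModel

variable (M : BModel σ)

/-- Evaluation of a term under an assignment. -/
def evalT (a : ℕ → M.D) : Term σ → M.D
  | .var n => a n
  | .func f ts => M.interpFunc f fun i => evalT a (ts i)

/-- Truth of a formula at a world, under an assignment of domain
elements to variables (Routley–Meyer truth conditions). -/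
def Truth : M.W → (ℕ → M.D) → Formula σ → Prop
  | _, _, .falsum => False
  | _, _, .verum => True
  | _, a, .equal t u => M.evalT a t = M.evalT a u
  | w, a, .rel r ts => M.V w r fun i => M.evalT a (ts i)
  | w, a, .and A B => Truth w a A ∧ Truth w a B
  | w, a, .or A B => Truth w a A ∨ Truth w a B
  | w, a, .neg A => ¬ Truth (M.star w) a A
  | w, a, .imp A B => ∀ w₁ w₂, M.R w w₁ w₂ → Truth w₁ a A → Truth w₂ a B
  | w, a, .all x A => ∀ d : M.D, Truth w (Function.update a x d) A
  | w, a, .ex x A => ∃ d : M.D, Truth w (Function.update a x d) A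

/-- `M` satisfies `A` (at the designated world, under every assignment). -/
def SatAx (A : Formula σ) : Prop := ∀ a : ℕ → M.D, M.Truth M.s a A

/-- `M` satisfies the theory `T` at its designated world. -/
def SatTheory (T : Set (Formula σ)) : Prop := ∀ A ∈ T, M.SatAx A

/-- Seriality: every world sees some pair via `R`. -/
def Serial : Prop := ∀ x : M.W, ∃ y z, M.R x y z

/-- The frame condition corresponding to the axiom `K`: `Rαβγ → Rsαγ`. -/
def Kcond : Prop := ∀ α β γ, M.R α β γ → M.R M.s α γ

/-- The additional frame conditions making a `B`-model an `RM`-model. -/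
def IsRM : Prop :=
  (∀ α β γ, M.R α β γ → M.R α (M.star γ) (M.star β)) ∧
  (∀ α β γ, M.R α β γ → M.R α γ β) ∧
  (∀ α, M.R α α α) ∧
  (∀ α β γ δ, (∃ x, M.R α β x ∧ M.R x γ δ) → ∃ y, M.R α y δ ∧ M.R β γ y) ∧
  (∀ α β γ, M.R α β γ → M.R M.s α γ ∨ M.R M.s β γ)

end BModel

/-- Semantic entailment over a class `C` of `B`-models: every model in `C`
whose designated world satisfies all of `T` also satisfies `A` at its
designated world. -/
def Entails (C : BModel σ → Prop) (T : Set (Formula σ)) (A : Formula σ) : Prop :=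
  ∀ M : BModel σ, C M → M.SatTheory T → M.SatAx A

end RM


open RM

/-- The signature of DLO: no function symbols, one binary relation `<`. -/
def dloSig : Signature := ⟨Empty, fun e => e.elim, Unit, fun _ => 2⟩

namespace DLO

/-- Variable `n` as a term of the language of DLO. -/
def v (n : ℕ) : Term dloSig := .var n

/-- The atomic formula `t < u`. -/
def lt (t u : Term dloSig) : Formula dloSig := .rel () ![t, u]

/-- A1: `∀x(x<x → ⊥)`. -/
def ax1 : Formula dloSig := .all 0 (.imp (lt (v 0) (v 0)) .falsum)
/-- A2: `∀x,y(x=y ∨ x<y ∨ y<x)`. -/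
def ax2 : Formula dloSig :=
  .all 0 (.all 1 (.or (.equal (v 0) (v 1)) (.or (lt (v 0) (v 1)) (lt (v 1) (v 0)))))
/-- A3: `∀x,y,z((x<y ∧ y<z) → x<z)`. -/
def ax3 : Formula dloSig :=
  .all 0 (.all 1 (.all 2 (.imp (.and (lt (v 0) (v 1)) (lt (v 1) (v 2))) (lt (v 0) (v 2)))))
/-- A4: `∀x,y(x<y → ∃z(x<z ∧ z<y))`. -/
def ax4 : Formula dloSig :=
  .all 0 (.all 1 (.imp (lt (v 0) (v 1)) (.ex 2 (.and (lt (v 0) (v 2)) (lt (v 2) (v 1))))))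
/-- A5: `∀x∃y(x<y)`. -/
def ax5 : Formula dloSig := .all 0 (.ex 1 (lt (v 0) (v 1)))
/-- A6: `∀x∃y(y<x)`. -/
def ax6 : Formula dloSig := .all 0 (.ex 1 (lt (v 1) (v 0)))

/-- The theory DLO of dense linear orders without endpoints. -/
def theory : Set (Formula dloSig) := {ax1, ax2, ax3, ax4, ax5, ax6}

end DLO


namespace DLO

variable {M : BModel dloSig}

/-- The interpretation of `<` at the world `w`. -/
def ltAt (M : BModel dloSig) (w : M.W) (x y : M.D) : Prop := M.V w () ![x, y]

theorem truth_lt (w : M.W) (a : ℕ → M.D) (i j : ℕ) :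
    M.Truth w a (lt (v i) (v j)) ↔ ltAt M w (a i) (a j) := by
  have h : (fun k : Fin 2 => M.evalT a ((![v i, v j] : Fin 2 → Term dloSig) k))
      = ![a i, a j] := by
    funext k
    fin_cases k <;> rfl
  exact iff_of_eq (congrArg (M.V w ()) h)

theorem V_iff_ltAt (w : M.W) (r : dloSig.Rel) (u : Fin (dloSig.rarity r) → M.D) :
    M.V w r u ↔ ltAt M w (u (0 : Fin 2)) (u (1 : Fin 2)) := by
  have h : u = ![u (0 : Fin 2), u (1 : Fin 2)] := by
    funext (k : Fin 2)
    fin_cases k <;> rfl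
  exact iff_of_eq (congrArg (M.V w ()) h)

theorem ltAt_irrefl (hT : M.SatTheory theory) (w : M.W) (x : M.D) : ¬ ltAt M w x x := by
  intro h
  refine hT ax1 (by simp [theory]) (fun _ => x) x w w (M.base w) ?_
  rw [truth_lt]
  simpa using h

theorem ltAt_trichotomy (hT : M.SatTheory theory) (x y : M.D) :
    x = y ∨ ltAt M M.s x y ∨ ltAt M M.s y x := by
  have h := hT ax2 (by simp [theory]) (fun _ => x) x y
  simp only [BModel.Truth, truth_lt] at h
  simpa [v, BModel.evalT] using h

theorem ltAt_trans (hT : M.SatTheory theory) (w : M.W) {x y z : M.D}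
    (hxy : ltAt M w x y) (hyz : ltAt M w y z) : ltAt M w x z := by
  have h := hT ax3 (by simp [theory]) (fun _ => x) x y z w w (M.base w)
  simp only [BModel.Truth, truth_lt] at h
  simpa using h (by simpa using ⟨hxy, hyz⟩)

theorem ltAt_dense (hT : M.SatTheory theory) {x y : M.D} (hxy : ltAt M M.s x y) :
    ∃ z, ltAt M M.s x z ∧ ltAt M M.s z y := by
  have h := hT ax4 (by simp [theory]) (fun _ => x) x y M.s M.s (M.base M.s)
  simp only [BModel.Truth, truth_lt] at h
  simpa using h (by simpa using hxy)

theorem ltAt_exists_gt (hT : M.SatTheory theory) (x : M.D) : ∃ y, ltAt M M.s x y := by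
  have h := hT ax5 (by simp [theory]) (fun _ => x) x
  simpa [BModel.Truth, truth_lt] using h

theorem ltAt_exists_lt (hT : M.SatTheory theory) (x : M.D) : ∃ y, ltAt M M.s y x := by
  have h := hT ax6 (by simp [theory]) (fun _ => x) x
  simpa [BModel.Truth, truth_lt] using h

/-- Under `K` the designated world lies below every world, and a linear strict order has no
proper extension to a strict order, so `<` is interpreted alike at all worlds. -/
theorem ltAt_iff_ltAt_s (hT : M.SatTheory theory) (hK : M.Kcond) (w : M.W) (x y : M.D) :
    ltAt M w x y ↔ ltAt M M.s x y := by
  have up {x y : M.D} (h : ltAt M M.s x y) : ltAt M w x y :=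
    M.hered _ _ (hK _ _ _ (M.base w)) _ _ h
  refine ⟨fun h => ?_, up⟩
  rcases ltAt_trichotomy hT x y with rfl | h' | h'
  · exact (ltAt_irrefl hT w x h).elim
  · exact h'
  · exact (ltAt_irrefl hT w x (ltAt_trans hT w h (up h'))).elim

/-- Two tuples indexed by `F` have the same order type. -/
def SameOrderType {D : Type*} (r : D → D → Prop) (F : Finset ℕ) (a b : ℕ → D) : Prop :=
  ∀ i ∈ F, ∀ j ∈ F, (a i = a j ↔ b i = b j) ∧ (r (a i) (a j) ↔ r (b i) (b j))

theorem SameOrderType.symm {D : Type*} {r : D → D → Prop} {F : Finset ℕ} {a b : ℕ → D}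
    (h : SameOrderType r F a b) : SameOrderType r F b a :=
  fun i hi j hj => ⟨(h i hi j hj).1.symm, (h i hi j hj).2.symm⟩

theorem SameOrderType.exists_update {D : Type*} [LinearOrder D] [DenselyOrdered D]
    [NoMinOrder D] [NoMaxOrder D] {F : Finset ℕ} {a b : ℕ → D}
    (h : SameOrderType (· < ·) F a b) (x : ℕ) (d : D) :
    ∃ e, SameOrderType (· < ·) (insert x F)
      (Function.update a x d) (Function.update b x e) := by
  have : Nonempty D := ⟨d⟩
  suffices ∃ e, ∀ i ∈ F, (a i = d ↔ b i = e) ∧ (a i < d ↔ b i < e) ∧ (d < a i ↔ e < b i) by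
    obtain ⟨e, he⟩ := this
    refine ⟨e, fun i hi j hj => ?_⟩
    rw [Finset.mem_insert] at hi hj
    by_cases hix : i = x <;> by_cases hjx : j = x
    · simp [hix, hjx]
    · have := he j (hj.resolve_left hjx)
      simp only [hix, Function.update_self, Function.update_of_ne hjx]
      exact ⟨by rw [eq_comm, this.1, eq_comm], this.2.2⟩
    · have := he i (hi.resolve_left hix)
      simp only [hjx, Function.update_self, Function.update_of_ne hix]
      exact ⟨this.1, this.2.1⟩
    · simp only [Function.update_of_ne hix, Function.update_of_ne hjx]
      exact h i (hi.resolve_left hix) j (hj.resolve_left hjx)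
  by_cases hd : ∃ k ∈ F, a k = d
  · obtain ⟨k, hk, rfl⟩ := hd
    exact ⟨b k, fun i hi => ⟨(h i hi k hk).1, (h i hi k hk).2, (h k hk i hi).2⟩⟩
  · push Not at hd
    obtain ⟨e, hlo, hhi⟩ := Order.exists_between_finsets
      ((F.filter (a · < d)).image b) ((F.filter (d < a ·)).image b) (by
        simp only [Finset.mem_image, Finset.mem_filter]
        rintro _ ⟨i, ⟨hi, hid⟩, rfl⟩ _ ⟨j, ⟨hj, hjd⟩, rfl⟩
        exact (h i hi j hj).2.1 (hid.trans hjd))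
    refine ⟨e, fun i hi => ?_⟩
    rcases (hd i hi).lt_or_gt with hlt | hgt
    · have := hlo (b i) (Finset.mem_image_of_mem b (by simp [hi, hlt]))
      simp [hlt, hlt.ne, hlt.not_gt, this, this.ne, this.not_gt]
    · have := hhi (b i) (Finset.mem_image_of_mem b (by simp [hi, hgt]))
      simp [hgt, hgt.ne', hgt.not_gt, this, this.ne', this.not_gt]

/-- The extension property for tuples with the same order type in a model of `DLO`. -/
theorem exists_sameOrderType_update (hT : M.SatTheory theory) {F : Finset ℕ}
    {a b : ℕ → M.D} (h : SameOrderType (ltAt M M.s) F a b) (x : ℕ) (d : M.D) :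
    ∃ e, SameOrderType (ltAt M M.s) (insert x F)
      (Function.update a x d) (Function.update b x e) := by
  classical
  have : IsStrictTotalOrder M.D (ltAt M M.s) :=
    { irrefl := ltAt_irrefl hT M.s
      trans := fun _ _ _ => ltAt_trans hT M.s
      trichotomous := fun x y hxy hyx =>
        ((ltAt_trichotomy hT x y).resolve_right (by tauto)) }
  let _ : LinearOrder M.D := linearOrderOfSTO (ltAt M M.s)
  have : DenselyOrdered M.D := ⟨fun _ _ => ltAt_dense hT⟩
  have : NoMinOrder M.D := ⟨ltAt_exists_lt hT⟩
  have : NoMaxOrder M.D := ⟨ltAt_exists_gt hT⟩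
  exact SameOrderType.exists_update (D := M.D) h x d

theorem term_eq_var (t : Term dloSig) : ∃ n, t = .var n := by
  cases t with
  | var n => exact ⟨n, rfl⟩
  | func f _ => exact Empty.elim f

theorem fv_finite (A : Formula dloSig) : A.fv.Finite := by
  have ht (t : Term dloSig) : t.fv.Finite := by
    obtain ⟨n, rfl⟩ := term_eq_var t
    exact Set.finite_singleton n
  induction A with
  | falsum => exact Set.finite_empty
  | verum => exact Set.finite_empty
  | equal t u => exact (ht t).union (ht u)
  | rel r ts => exact Set.finite_iUnion fun i => ht (ts i)
  | and A B hA hB => exact hA.union hB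
  | or A B hA hB => exact hA.union hB
  | imp A B hA hB => exact hA.union hB
  | neg A hA => exact hA
  | all x A hA => exact hA.sdiff
  | ex x A hA => exact hA.sdiff

/-- At every world, truth of a formula depends only on the order type of its parameters. -/
theorem truth_iff_of_sameOrderType (hK : M.Kcond) (hT : M.SatTheory theory)
    (A : Formula dloSig) :
    ∀ (F : Finset ℕ), A.fv ⊆ F → ∀ (w : M.W) (a b : ℕ → M.D),
      SameOrderType (ltAt M M.s) F a b → (M.Truth w a A ↔ M.Truth w b A) := by
  have hterm (F : Finset ℕ) (t : Term dloSig) (ht : t.fv ⊆ F) :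
      ∃ n ∈ F, ∀ a : ℕ → M.D, M.evalT a t = a n := by
    obtain ⟨n, rfl⟩ := term_eq_var t
    exact ⟨n, ht rfl, fun _ => rfl⟩
  have hinsert {x : ℕ} {A : Formula dloSig} {F : Finset ℕ} (hF : A.fv \ {x} ⊆ (F : Set ℕ)) :
      A.fv ⊆ (insert x F : Finset ℕ) := by
    rw [Finset.coe_insert, Set.insert_eq]
    exact Set.sdiff_subset_iff.1 hF
  induction A with
  | falsum => exact fun _ _ _ _ _ _ => Iff.rfl
  | verum => exact fun _ _ _ _ _ _ => Iff.rfl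
  | equal t u =>
    intro F hF w a b h
    obtain ⟨i, hi, hti⟩ := hterm F t (Set.subset_union_left.trans hF)
    obtain ⟨j, hj, huj⟩ := hterm F u (Set.subset_union_right.trans hF)
    simp only [BModel.Truth, hti, huj]
    exact (h i hi j hj).1
  | rel r ts =>
    intro F hF w a b h
    have hs (k) : (ts k).fv ⊆ F := (Set.subset_iUnion (fun k => (ts k).fv) k).trans hF
    obtain ⟨i, hi, hti⟩ := hterm F (ts (0 : Fin 2)) (hs _)
    obtain ⟨j, hj, htj⟩ := hterm F (ts (1 : Fin 2)) (hs _)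
    simp only [BModel.Truth, V_iff_ltAt, ltAt_iff_ltAt_s hT hK w, hti, htj]
    exact (h i hi j hj).2
  | and A B hA hB =>
    intro F hF w a b h
    exact and_congr (hA F (Set.subset_union_left.trans hF) w a b h)
      (hB F (Set.subset_union_right.trans hF) w a b h)
  | or A B hA hB =>
    intro F hF w a b h
    exact or_congr (hA F (Set.subset_union_left.trans hF) w a b h)
      (hB F (Set.subset_union_right.trans hF) w a b h)
  | neg A hA =>
    intro F hF w a b h
    exact not_congr (hA F hF _ a b h)
  | imp A B hA hB =>
    intro F hF w a b h
    exact forall₃_congr fun w₁ w₂ _ =>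
      imp_congr (hA F (Set.subset_union_left.trans hF) w₁ a b h)
        (hB F (Set.subset_union_right.trans hF) w₂ a b h)
  | all x A hA =>
    have key (F : Finset ℕ) (hF : A.fv \ {x} ⊆ (F : Set ℕ)) (w : M.W) (a b : ℕ → M.D)
        (h : SameOrderType (ltAt M M.s) F a b) (ha : M.Truth w a (.all x A)) :
        M.Truth w b (.all x A) := fun d => by
      obtain ⟨e, he⟩ := exists_sameOrderType_update hT h.symm x d
      exact (hA _ (hinsert hF) w _ _ he).2 (ha e)
    exact fun F hF w a b h => ⟨key F hF w a b h, key F hF w b a h.symm⟩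
  | ex x A hA =>
    have key (F : Finset ℕ) (hF : A.fv \ {x} ⊆ (F : Set ℕ)) (w : M.W) (a b : ℕ → M.D)
        (h : SameOrderType (ltAt M M.s) F a b) :
        M.Truth w a (.ex x A) → M.Truth w b (.ex x A) := fun ⟨d, hd⟩ => by
      obtain ⟨e, he⟩ := exists_sameOrderType_update hT h x d
      exact ⟨e, (hA _ (hinsert hF) w _ _ he).1 hd⟩
    exact fun F hF w a b h => ⟨key F hF w a b h, key F hF w b a h.symm⟩

end DLO

/-- A property of assignments that depends only on the truth at `s` of finitely many
quantifier-free formulas with classical negation is definable by a quantifier-free formula. -/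
theorem RM.BModel.exists_qfree_of_invariant {σ : Signature} (M : BModel σ)
    (L : List (Formula σ))
    (hL : ∀ p ∈ L, p.QFree ∧ ∀ a, M.Truth M.s a (.neg p) ↔ ¬ M.Truth M.s a p)
    (S : (ℕ → M.D) → Prop)
    (hS : ∀ a b, (∀ p ∈ L, M.Truth M.s a p ↔ M.Truth M.s b p) → (S a ↔ S b)) :
    ∃ B : Formula σ, B.QFree ∧ ∀ a, S a ↔ M.Truth M.s a B := by
  induction L generalizing S with
  | nil =>
    obtain ⟨d⟩ := M.dne
    by_cases h : S fun _ => d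
    · exact ⟨.verum, trivial, fun a => iff_of_true ((hS a _ (by simp)).2 h) trivial⟩
    · exact ⟨.falsum, trivial, fun a => iff_of_false (mt (hS a _ (by simp)).1 h) id⟩
  | cons p L ih =>
    rw [List.forall_mem_cons] at hL
    obtain ⟨⟨hp, hneg⟩, hL⟩ := hL
    have hproj (q : (ℕ → M.D) → Prop) : ∃ B : Formula σ, B.QFree ∧
        ∀ a, (∃ b, (∀ p ∈ L, M.Truth M.s a p ↔ M.Truth M.s b p) ∧ q b ∧ S b) ↔
          M.Truth M.s a B :=
      ih hL _ fun a b hab => exists_congr fun c =>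
        and_congr_left' (forall₂_congr fun p h => iff_congr (hab p h) Iff.rfl)
    obtain ⟨B₁, hB₁, h₁⟩ := hproj fun b => M.Truth M.s b p
    obtain ⟨B₂, hB₂, h₂⟩ := hproj fun b => ¬ M.Truth M.s b p
    refine ⟨.or (.and p B₁) (.and (.neg p) B₂), ⟨⟨hp, hB₁⟩, hp, hB₂⟩, fun a => ?_⟩
    change S a ↔ (M.Truth M.s a p ∧ M.Truth M.s a B₁) ∨
      (M.Truth M.s a (.neg p) ∧ M.Truth M.s a B₂)
    rw [hneg, ← h₁, ← h₂]
    constructor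
    · intro ha
      by_cases hpa : M.Truth M.s a p
      · exact .inl ⟨hpa, a, fun _ _ => Iff.rfl, hpa, ha⟩
      · exact .inr ⟨hpa, a, fun _ _ => Iff.rfl, hpa, ha⟩
    · rintro (⟨hpa, b, hab, hpb, hb⟩ | ⟨hpa, b, hab, hpb, hb⟩)
      · exact (hS a b (List.forall_mem_cons.2 ⟨iff_of_true hpa hpb, hab⟩)).2 hb
      · exact (hS a b (List.forall_mem_cons.2 ⟨iff_of_false hpa hpb, hab⟩)).2 hb

/-- **Model-wise quantifier elimination for DLO over B + K**: in any model of
DLO over **B** + `K`, every formula defines at the designated world the same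
relation as some quantifier-free formula. -/
theorem stmt_17 (M : BModel dloSig) (hK : M.Kcond) (hT : M.SatTheory DLO.theory)
    (A : Formula dloSig) :
    ∃ B : Formula dloSig, B.QFree ∧
      ∀ a : ℕ → M.D, M.Truth M.s a A ↔ M.Truth M.s a B := by
  let F := (DLO.fv_finite A).toFinset
  let L : List (Formula dloSig) := (F ×ˢ F).toList.flatMap fun ij =>
    [.equal (DLO.v ij.1) (DLO.v ij.2), DLO.lt (DLO.v ij.1) (DLO.v ij.2)]
  have mem_L (p : Formula dloSig) : p ∈ L ↔ ∃ i ∈ F, ∃ j ∈ F,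
      p = .equal (DLO.v i) (DLO.v j) ∨ p = DLO.lt (DLO.v i) (DLO.v j) := by
    simp only [L, List.mem_flatMap, Finset.mem_toList, Finset.mem_product, Prod.exists,
      List.mem_cons, List.not_mem_nil, or_false]
    grind
  refine M.exists_qfree_of_invariant L (fun p hp => ?_) _ fun a b hab => ?_
  · obtain ⟨i, -, j, -, rfl | rfl⟩ := (mem_L p).1 hp
    · exact ⟨trivial, fun a => Iff.rfl⟩
    · refine ⟨trivial, fun a => not_congr ?_⟩
      rw [DLO.truth_lt, DLO.truth_lt, DLO.ltAt_iff_ltAt_s hT hK]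
  · refine DLO.truth_iff_of_sameOrderType hK hT A F (by simp [F]) M.s a b
      fun i hi j hj => ⟨?_, ?_⟩
    · exact hab _ ((mem_L _).2 ⟨i, hi, j, hj, .inl rfl⟩)
    · rw [← DLO.truth_lt, ← DLO.truth_lt]
      exact hab _ ((mem_L _).2 ⟨i, hi, j, hj, .inr rfl⟩)
end

section
/- Quantifier elimination for ACF over serial B-models: let C be any class of B-models over the signature of ACF each of which satisfies seriality. Then ACF admits quantifier elimination over C: for every formula A of the language of ACF there is a quantifier-free formula B such that ACF ⊨_C A↔B. (A key intermediate fact: in any B-model with serial frame whose designated world satisfies ACF, truth of every formula is world-independent, since the signature of ACF contains no predicate symbols other than =, which is interpreted as identity at every world.) -/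
open RM

/-- Function symbols of the signature of ACF. -/
inductive ACFFunc : Type where
  | plus | times | neg | inv | zero | one

/-- The signature of ACF: function symbols `+ × − ⁻¹ 0 1` and no predicate
symbols (equality is logical). -/
def acfSig : Signature :=
  ⟨ACFFunc,
   fun f => match f with
     | .plus => 2 | .times => 2 | .neg => 1 | .inv => 1 | .zero => 0 | .one => 0,
   Empty, fun r => r.elim⟩

namespace ACF

def v (n : ℕ) : Term acfSig := .var n
def add (t u : Term acfSig) : Term acfSig := .func .plus ![t, u]
def mul (t u : Term acfSig) : Term acfSig := .func .times ![t, u]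
def minus (t : Term acfSig) : Term acfSig := .func .neg ![t]
def inv (t : Term acfSig) : Term acfSig := .func .inv ![t]
def c0 : Term acfSig := .func .zero ![]
def c1 : Term acfSig := .func .one ![]

/-- `t ^ n` as a term (`t ^ 0 = 1`). -/
def pow (t : Term acfSig) : ℕ → Term acfSig
  | 0 => c1
  | n + 1 => mul t (pow t n)

/-- The sum of a list of terms. -/
def tsum : List (Term acfSig) → Term acfSig
  | [] => c0
  | [t] => t
  | t :: u :: ts => add t (tsum (u :: ts))

/-- The term `yⁿ + x₁·yⁿ⁻¹ + ⋯ + xₙ`, where `y` is the variable `0` and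
`xᵢ` is the variable `i`. -/
def poly (n : ℕ) : Term acfSig :=
  tsum (pow (v 0) n :: (List.range n).map fun i => mul (v (i + 1)) (pow (v 0) (n - 1 - i)))

/-- Universal closure over a list of variables. -/
def alls (l : List ℕ) (A : Formula acfSig) : Formula acfSig := l.foldr Formula.all A

def ax1 : Formula acfSig :=
  .all 0 (.all 1 (.all 2 (.equal (add (add (v 0) (v 1)) (v 2)) (add (v 0) (add (v 1) (v 2))))))
def ax2 : Formula acfSig := .all 0 (.equal (add (v 0) c0) (v 0))
def ax3 : Formula acfSig := .all 0 (.equal (add (v 0) (minus (v 0))) c0)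
def ax4 : Formula acfSig := .all 0 (.all 1 (.equal (add (v 0) (v 1)) (add (v 1) (v 0))))
def ax5 : Formula acfSig :=
  .all 0 (.all 1 (.all 2 (.equal (mul (mul (v 0) (v 1)) (v 2)) (mul (v 0) (mul (v 1) (v 2))))))
def ax6 : Formula acfSig := .all 0 (.equal (mul (v 0) c1) (v 0))
def ax7 : Formula acfSig :=
  .all 0 (.imp (.neg (.equal (v 0) c0)) (.equal (mul (v 0) (inv (v 0))) c1))
def ax8 : Formula acfSig := .all 0 (.all 1 (.equal (mul (v 0) (v 1)) (mul (v 1) (v 0))))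
def ax9 : Formula acfSig :=
  .all 0 (.all 1 (.all 2 (.equal (mul (v 0) (add (v 1) (v 2))) (add (mul (v 0) (v 1)) (mul (v 0) (v 2))))))
def ax10 : Formula acfSig := .imp (.equal c0 c1) .falsum
/-- A11ₙ: `∀x₁,…,xₙ ∃y (yⁿ + x₁yⁿ⁻¹ + ⋯ + xₙ = 0)`, for each `n > 0`. -/
def ax11 (n : ℕ) : Formula acfSig :=
  alls ((List.range n).map (· + 1)) (.ex 0 (.equal (poly n) c0))

/-- The theory ACF of algebraically closed fields. -/
def theory : Set (Formula acfSig) :=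
  {ax1, ax2, ax3, ax4, ax5, ax6, ax7, ax8, ax9, ax10} ∪ {A | ∃ n : ℕ, 0 < n ∧ A = ax11 n}

end ACF


namespace ACFQE

open Polynomial PrimeSpectrum Topology

/-! ### World-independent semantics -/

/-- An interpretation of the function symbols of ACF on `D`. -/
abbrev Interp (D : Type) : Type :=
  (f : acfSig.Func) → (Fin (acfSig.farity f) → D) → D

/-- Evaluation of a term under an interpretation and an assignment. -/
def eval {D : Type} (I : Interp D) (a : ℕ → D) : Term acfSig → D
  | .var n => a n
  | .func f ts => I f fun i => eval I a (ts i)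

/-- Classical (Tarskian) satisfaction. -/
def Holds {D : Type} (I : Interp D) : (ℕ → D) → Formula acfSig → Prop
  | _, .falsum => False
  | _, .verum => True
  | a, .equal t u => eval I a t = eval I a u
  | _, .rel r _ => r.elim
  | a, .and A B => Holds I a A ∧ Holds I a B
  | a, .or A B => Holds I a A ∨ Holds I a B
  | a, .neg A => ¬ Holds I a A
  | a, .imp A B => Holds I a A → Holds I a B
  | a, .all x A => ∀ d : D, Holds I (Function.update a x d) A
  | a, .ex x A => ∃ d : D, Holds I (Function.update a x d) A

theorem evalT_eq_eval (M : BModel acfSig) (a : ℕ → M.D) (t : Term acfSig) :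
    M.evalT a t = eval M.interpFunc a t := by
  induction t with
  | var n => rfl
  | func f ts ih => simp only [BModel.evalT, eval, ih]

/-- In a serial model truth is world-independent and coincides with classical satisfaction. -/
theorem truth_iff_holds {M : BModel acfSig} (hM : M.Serial) (A : Formula acfSig) (w : M.W)
    (a : ℕ → M.D) : M.Truth w a A ↔ Holds M.interpFunc a A := by
  induction A generalizing w a with
  | falsum | verum => rfl
  | equal t u => simp only [BModel.Truth, Holds, evalT_eq_eval]
  | rel r _ => exact r.elim
  | and A B ihA ihB | or A B ihA ihB => simp only [BModel.Truth, Holds, ihA, ihB]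
  | neg A ih | all x A ih | ex x A ih => simp only [BModel.Truth, Holds, ih]
  | imp A B ihA ihB =>
    simp only [BModel.Truth, Holds, ihA, ihB]
    obtain ⟨y, z, h⟩ := hM w
    exact ⟨fun H => H y z h, fun H _ _ _ => H⟩

section eval

variable {D : Type} (I : Interp D) (a : ℕ → D) (t u : Term acfSig)

theorem eval_v (n : ℕ) : eval I a (ACF.v n) = a n := rfl

theorem eval_add : eval I a (ACF.add t u) = I ACFFunc.plus ![eval I a t, eval I a u] :=
  congrArg (I ACFFunc.plus) (funext fun i : Fin 2 => by fin_cases i <;> rfl)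

theorem eval_mul : eval I a (ACF.mul t u) = I ACFFunc.times ![eval I a t, eval I a u] :=
  congrArg (I ACFFunc.times) (funext fun i : Fin 2 => by fin_cases i <;> rfl)

theorem eval_minus : eval I a (ACF.minus t) = I ACFFunc.neg ![eval I a t] :=
  congrArg (I ACFFunc.neg) (funext fun i : Fin 1 => by fin_cases i; rfl)

theorem eval_inv : eval I a (ACF.inv t) = I ACFFunc.inv ![eval I a t] :=
  congrArg (I ACFFunc.inv) (funext fun i : Fin 1 => by fin_cases i; rfl)

theorem eval_c0 : eval I a ACF.c0 = I ACFFunc.zero ![] :=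
  congrArg (I ACFFunc.zero) (funext fun i : Fin 0 => i.elim0)

theorem eval_c1 : eval I a ACF.c1 = I ACFFunc.one ![] :=
  congrArg (I ACFFunc.one) (funext fun i : Fin 0 => i.elim0)

end eval

/-! ### Models of ACF are algebraically closed fields -/

open Classical in
/-- The interpretation of the symbols of ACF in a field, the inverse of `0` being `c`. -/
noncomputable def fieldInterp (K : Type) [Field K] (c : K) : Interp K
  | ACFFunc.plus => fun x : Fin 2 → K => x 0 + x 1
  | ACFFunc.times => fun x : Fin 2 → K => x 0 * x 1
  | ACFFunc.neg => fun x : Fin 1 → K => - x 0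
  | ACFFunc.inv => fun x : Fin 1 → K => if x 0 = 0 then c else (x 0)⁻¹
  | ACFFunc.zero => fun _ => 0
  | ACFFunc.one => fun _ => 1

section fieldInterp

variable {K : Type} [Field K] (c : K) (a : ℕ → K) (t u : Term acfSig)

theorem eval_fieldInterp_add : eval (fieldInterp K c) a (ACF.add t u) =
    eval (fieldInterp K c) a t + eval (fieldInterp K c) a u := rfl

theorem eval_fieldInterp_mul : eval (fieldInterp K c) a (ACF.mul t u) =
    eval (fieldInterp K c) a t * eval (fieldInterp K c) a u := rfl

theorem eval_fieldInterp_minus : eval (fieldInterp K c) a (ACF.minus t) =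
    - eval (fieldInterp K c) a t := rfl

theorem eval_fieldInterp_c0 : eval (fieldInterp K c) a ACF.c0 = 0 := rfl

theorem eval_fieldInterp_c1 : eval (fieldInterp K c) a ACF.c1 = 1 := rfl

theorem eval_fieldInterp_inv_c0 : eval (fieldInterp K c) a (ACF.inv ACF.c0) = c :=
  if_pos rfl

theorem eval_fieldInterp_pow (n : ℕ) : eval (fieldInterp K c) a (ACF.pow t n) =
    eval (fieldInterp K c) a t ^ n := by
  induction n with
  | zero => simp [ACF.pow, eval_fieldInterp_c1]
  | succ n ih => rw [ACF.pow, eval_fieldInterp_mul, ih, pow_succ']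

theorem eval_fieldInterp_tsum (l : List (Term acfSig)) :
    eval (fieldInterp K c) a (ACF.tsum l) = (l.map (eval (fieldInterp K c) a)).sum := by
  induction l using ACF.tsum.induct with
  | case1 => simp [ACF.tsum, eval_fieldInterp_c0]
  | case2 t => simp [ACF.tsum]
  | case3 t u ts ih => rw [ACF.tsum, eval_fieldInterp_add, ih, List.map_cons (l := u :: ts),
      List.sum_cons]

theorem eval_fieldInterp_poly (n : ℕ) : eval (fieldInterp K c) a (ACF.poly n) =
    a 0 ^ n + ∑ i ∈ Finset.range n, a (i + 1) * a 0 ^ (n - 1 - i) := by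
  rw [ACF.poly, eval_fieldInterp_tsum, Finset.sum_range, ← List.sum_ofFn, List.ofFn_eq_map]
  simp only [List.map_cons, List.sum_cons, List.map_map, eval_fieldInterp_pow, eval_v]
  congr 1
  rw [← List.map_coe_finRange_eq_range, List.map_map]
  congr 1
  refine List.map_congr_left fun i _ => ?_
  simp only [Function.comp_apply, eval_fieldInterp_mul, eval_fieldInterp_pow, eval_v]

end fieldInterp

theorem Holds.of_alls {D : Type} {I : Interp D} {a : ℕ → D} {A : Formula acfSig} {l : List ℕ}
    (h : Holds I a (ACF.alls l A)) : Holds I a A := by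
  induction l with
  | nil => exact h
  | cons x l ih =>
    refine ih ?_
    have := h (a x)
    rwa [Function.update_eq_self] at this

theorem isAlgClosed_of_holds {K : Type} [Field K] {c : K}
    (h : ∀ n, 0 < n → ∀ a : ℕ → K, Holds (fieldInterp K c) a (ACF.ax11 n)) :
    IsAlgClosed K := by
  refine .of_exists_root _ fun p hp hirr => ?_
  have hn : 0 < p.natDegree := hirr.natDegree_pos
  obtain ⟨y, hy⟩ := (h p.natDegree hn fun i => p.coeff (p.natDegree - i)).of_alls
  refine ⟨y, ?_⟩
  simp only [Holds, eval_fieldInterp_poly, eval_fieldInterp_c0, Function.update_self] at hy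
  rw [eval_eq_sum_range, Finset.sum_range_succ, hp.coeff_natDegree, one_mul, add_comm, ← hy,
    ← Finset.sum_range_reflect]
  congr 1
  refine Finset.sum_congr rfl fun i hi => ?_
  rw [Function.update_of_ne (Nat.succ_ne_zero i), Nat.sub_sub, Nat.add_comm 1 i]

/-- A structure satisfying ACF is an algebraically closed field, up to the value of `0⁻¹`. -/
theorem exists_field_of_holds {D : Type} (I : Interp D) (a : ℕ → D)
    (h : ∀ A ∈ ACF.theory, ∀ a, Holds I a A) :
    ∃ (_ : Field D) (_ : IsAlgClosed D) (c : D), I = fieldInterp D c := by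
  classical
  have h1 := h ACF.ax1 (by simp [ACF.theory]) a
  have h2 := h ACF.ax2 (by simp [ACF.theory]) a
  have h3 := h ACF.ax3 (by simp [ACF.theory]) a
  have h4 := h ACF.ax4 (by simp [ACF.theory]) a
  have h5 := h ACF.ax5 (by simp [ACF.theory]) a
  have h6 := h ACF.ax6 (by simp [ACF.theory]) a
  have h7 := h ACF.ax7 (by simp [ACF.theory]) a
  have h8 := h ACF.ax8 (by simp [ACF.theory]) a
  have h9 := h ACF.ax9 (by simp [ACF.theory]) a
  have h10 := h ACF.ax10 (by simp [ACF.theory]) a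
  have h11 : ∀ n, 0 < n → ∀ a, Holds I a (ACF.ax11 n) := fun n hn =>
    h _ (Or.inr ⟨n, hn, rfl⟩)
  simp only [ACF.ax1, ACF.ax2, ACF.ax3, ACF.ax4, ACF.ax5, ACF.ax6, ACF.ax7, ACF.ax8, ACF.ax9,
    ACF.ax10, Holds, eval_v, eval_add, eval_mul, eval_minus, eval_inv, eval_c0, eval_c1,
    Function.update_self, Function.update_of_ne (show (0 : ℕ) ≠ 1 by decide),
    Function.update_of_ne (show (0 : ℕ) ≠ 2 by decide),
    Function.update_of_ne (show (1 : ℕ) ≠ 2 by decide)] at h1 h2 h3 h4 h5 h6 h7 h8 h9 h10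
  let _ : Add D := ⟨fun x y => I ACFFunc.plus ![x, y]⟩
  let _ : Mul D := ⟨fun x y => I ACFFunc.times ![x, y]⟩
  let _ : Neg D := ⟨fun x => I ACFFunc.neg ![x]⟩
  let _ : Zero D := ⟨I ACFFunc.zero ![]⟩
  let _ : One D := ⟨I ACFFunc.one ![]⟩
  let inv (x : D) : D := I ACFFunc.inv ![x]
  let _ : Inv D := ⟨fun x => if x = 0 then 0 else inv x⟩
  let _ : Field D := Field.ofMinimalAxioms D h1
    (fun x => (h4 0 x).trans (h2 x)) (fun x => (h4 (-x) x).trans (h3 x)) h5 h8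
    (fun x => (h8 1 x).trans (h6 x))
    (fun x hx => (congrArg (x * ·) (if_neg hx)).trans (h7 x hx)) (if_pos rfl) h9
    ⟨0, 1, h10⟩
  have hI : I = fieldInterp D (inv 0) := by
    funext f x
    cases f with
    | plus => exact congrArg (I ACFFunc.plus) (funext fun i : Fin 2 => by fin_cases i <;> rfl)
    | times => exact congrArg (I ACFFunc.times) (funext fun i : Fin 2 => by fin_cases i <;> rfl)
    | neg => exact congrArg (I ACFFunc.neg) (funext fun i : Fin 1 => by fin_cases i; rfl)
    | inv =>
      have hx : I ACFFunc.inv x = inv (x (0 : Fin 1)) :=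
        congrArg (I ACFFunc.inv) (funext fun i : Fin 1 => by fin_cases i; rfl)
      refine hx.trans ?_
      by_cases h0 : x (0 : Fin 1) = 0
      · exact (congrArg inv h0).trans (if_pos h0).symm
      · exact ((if_neg h0).trans (if_neg h0)).symm
    | zero => exact congrArg (I ACFFunc.zero) (funext fun i : Fin 0 => i.elim0)
    | one => exact congrArg (I ACFFunc.one) (funext fun i : Fin 0 => i.elim0)
  exact ⟨inferInstance, isAlgClosed_of_holds (c := inv 0) (hI ▸ h11), inv 0, hI⟩

/-! ### Points of fibres over algebraically closed fields -/

/-- Two ring homomorphisms to fields with the same kernel factor through a common field. -/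
theorem exists_common_subfield {R K L : Type} [CommRing R] [Field K] [Field L]
    (φ : R →+* K) (χ : R →+* L) (h : RingHom.ker χ = RingHom.ker φ) :
    ∃ (κ : Type) (_ : Field κ) (ι : R →+* κ) (i : κ →+* K) (j : κ →+* L),
      φ = i.comp ι ∧ χ = j.comp ι := by
  have hp : (RingHom.ker φ).IsPrime := RingHom.ker_isPrime φ
  let A := R ⧸ RingHom.ker φ
  let i : A →+* K := Ideal.Quotient.lift _ φ fun a ha => ha
  let j : A →+* L := Ideal.Quotient.lift _ χ fun a ha => by rwa [← h] at ha
  have hi : Function.Injective i := RingHom.lift_injective_of_ker_le_ideal _ _ le_rfl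
  have hj : Function.Injective j := RingHom.lift_injective_of_ker_le_ideal _ _ h.le
  refine ⟨FractionRing A, inferInstance, (algebraMap A _).comp (Ideal.Quotient.mk _),
    IsFractionRing.lift hi, IsFractionRing.lift hj, ?_, ?_⟩ <;>
  · ext x
    simp only [RingHom.comp_apply, IsFractionRing.lift_algebraMap]
    rfl

/-- If a basic constructible subset of `Spec R[X]` has a point over the kernel of a homomorphism
from `R` to an algebraically closed field `K`, then it has a `K`-rational one. -/
theorem exists_eval₂_ne_zero {R K L : Type} [CommRing R] [Field K] [IsAlgClosed K] [Field L]
    (φ : R →+* K) (χ : R[X] →+* L) (h : RingHom.ker (χ.comp C) = RingHom.ker φ) (f : R[X])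
    (hf : χ f ≠ 0) : ∃ d : K, eval₂ φ d f ≠ 0 ∧ ∀ g, χ g = 0 → eval₂ φ d g = 0 := by
  obtain ⟨κ, _, ι, i, j, rfl, hχ⟩ := exists_common_subfield φ (χ.comp C) h
  let _ := i.toAlgebra
  let _ := j.toAlgebra
  obtain ⟨y, key⟩ : ∃ y : L, ∀ g, χ g = aeval y (g.map ι) := by
    refine ⟨χ X, fun g => ?_⟩
    have : χ = (eval₂RingHom (χ.comp C) (χ X)) := by ext <;> simp
    conv_lhs => rw [this]
    rw [hχ, aeval_def, eval₂_map, coe_eval₂RingHom]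
    rfl
  have key' (d : K) (g : R[X]) : eval₂ (i.comp ι) d g = aeval d (g.map ι) := by
    rw [aeval_def, eval₂_map]
    rfl
  simp only [key, key'] at hf ⊢
  by_cases hy : IsIntegral κ y
  · obtain ⟨d, hd⟩ := IsAlgClosed.exists_aeval_eq_zero K (minpoly κ y)
      (minpoly.degree_pos hy).ne'
    have hm := minpoly.eq_of_irreducible_of_monic (minpoly.irreducible hy) hd (minpoly.monic hy)
    simp only [← minpoly.dvd_iff, hm, ne_eq] at hf ⊢
    exact ⟨d, hf, fun _ => id⟩
  · have ht : Transcendental κ y := fun H => hy H.isIntegral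
    rw [transcendental_iff] at ht
    have hf0 : (f.map ι).map i ≠ 0 := by
      rw [Polynomial.map_ne_zero_iff i.injective]
      rintro h0
      simp [h0] at hf
    obtain ⟨d, hd⟩ : ∃ d, ((f.map ι).map i).eval d ≠ 0 := by
      by_contra! H
      exact hf0 (Polynomial.funext fun d => by simpa using H d)
    refine ⟨d, ?_, fun g hg => by rw [ht _ hg, map_zero]⟩
    rwa [eval_map] at hd

/-! ### Constructible predicates -/

/-- The coordinate ring: `none` stands for the value of `0⁻¹`, `some i` for the `i`-th variable. -/
abbrev Coord : Type := MvPolynomial (Option ℕ) ℤ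

/-- An algebraically closed field with a value for `0⁻¹` and an assignment. -/
structure Pt where
  K : Type
  [field : Field K]
  [algClosed : IsAlgClosed K]
  c : K
  a : ℕ → K

attribute [instance] Pt.field Pt.algClosed

namespace Pt

variable (P : Pt)

/-- The interpretation of ACF at a point. -/
noncomputable def interp : Interp P.K := fieldInterp P.K P.c

/-- Evaluation of polynomials at a point. -/
noncomputable def hom : Coord →+* P.K :=
  MvPolynomial.eval₂Hom (Int.castRingHom P.K) fun o => o.elim P.c P.a

/-- The prime ideal of the polynomials vanishing at a point. -/
noncomputable def prime : PrimeSpectrum Coord := ⟨RingHom.ker P.hom, RingHom.ker_isPrime _⟩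

/-- Change the value of the variable `x` to `d`. -/
def upd (x : ℕ) (d : P.K) : Pt := { P with a := Function.update P.a x d }

end Pt

/-- View polynomials as polynomials in the variable `x`. -/
noncomputable def isolate (x : ℕ) : Coord →+* Coord[X] :=
  MvPolynomial.eval₂Hom (Int.castRingHom _) fun o =>
    if o = some x then X else C (MvPolynomial.X o)

theorem eval₂Hom_update {K : Type} [Field K] (c : K) (a : ℕ → K) (x : ℕ) (d : K) :
    MvPolynomial.eval₂Hom (Int.castRingHom K) (fun o => o.elim c (Function.update a x d)) =
      (eval₂RingHom (MvPolynomial.eval₂Hom (Int.castRingHom K) fun o => o.elim c a) d).comp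
        (isolate x) := by
  refine MvPolynomial.ringHom_ext (fun n => ?_) fun o => ?_
  · rw [eq_intCast, map_intCast, map_intCast]
  · rw [RingHom.comp_apply, isolate, MvPolynomial.eval₂Hom_X', MvPolynomial.eval₂Hom_X']
    rcases o with _ | i
    · simp
    · by_cases hi : i = x
      · subst hi
        simp
      · simp [hi]

theorem Pt.hom_upd (P : Pt) (x : ℕ) (d : P.K) :
    (P.upd x d).hom = (eval₂RingHom P.hom d).comp (isolate x) :=
  eval₂Hom_update P.c P.a x d

/-- A predicate on points cut out by a constructible subset of the spectrum. -/
def Constr (Q : Pt → Prop) : Prop :=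
  ∃ S : Set (PrimeSpectrum Coord), IsConstructible S ∧ ∀ P, Q P ↔ P.prime ∈ S

namespace Constr

variable {Q Q' : Pt → Prop}

theorem and (h : Constr Q) (h' : Constr Q') : Constr fun P => Q P ∧ Q' P := by
  obtain ⟨S, hS, hQ⟩ := h
  obtain ⟨T, hT, hQ'⟩ := h'
  exact ⟨S ∩ T, hS.inter hT, fun P => and_congr (hQ P) (hQ' P)⟩

theorem not (h : Constr Q) : Constr fun P => ¬ Q P := by
  obtain ⟨S, hS, hQ⟩ := h
  exact ⟨Sᶜ, isConstructible_compl.2 hS, fun P => not_congr (hQ P)⟩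

theorem or (h : Constr Q) (h' : Constr Q') : Constr fun P => Q P ∨ Q' P := by
  simpa only [not_and_or, not_not] using (h.not.and h'.not).not

theorem imp (h : Constr Q) (h' : Constr Q') : Constr fun P => Q P → Q' P := by
  simpa only [imp_iff_not_or] using h.not.or h'

theorem const (p : Prop) : Constr fun _ => p := by
  by_cases hp : p
  · exact ⟨Set.univ, .univ, fun P => by simp [hp]⟩
  · exact ⟨∅, .empty, fun P => by simp [hp]⟩

theorem hom_eq_zero (p : Coord) : Constr fun P => P.hom p = 0 :=
  ⟨(basicOpen p : Set (PrimeSpectrum Coord))ᶜ, isConstructible_compl.2 isConstructible_basicOpen,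
    fun P => by simp [Pt.prime]⟩

/-- Chevalley's theorem: constructible predicates are closed under existential quantification. -/
theorem ex (h : Constr Q) (x : ℕ) : Constr fun P => ∃ d, Q (P.upd x d) := by
  obtain ⟨S, hS, hQ⟩ := h
  obtain ⟨T, rfl⟩ := exists_constructibleSetData_iff.2 hS
  refine ⟨comap C '' (T.map (isolate x)).toSet,
    isConstructible_comap_C (T.map (isolate x)).isConstructible_toSet, fun P => ?_⟩
  let pt (d : P.K) : PrimeSpectrum Coord[X] :=
    ⟨RingHom.ker (eval₂RingHom P.hom d), RingHom.ker_isPrime _⟩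
  have hpt (d : P.K) : (P.upd x d).prime = comap (isolate x) (pt d) := by
    ext p
    change (P.upd x d).hom p = 0 ↔ eval₂RingHom P.hom d (isolate x p) = 0
    rw [Pt.hom_upd]
    rfl
  have hmem (d : P.K) : Q (P.upd x d) ↔ pt d ∈ (T.map (isolate x)).toSet := by
    rw [hQ, hpt, ConstructibleSetData.toSet_map, Set.mem_preimage]
  simp only [hmem]
  constructor
  · rintro ⟨d, hd⟩
    refine ⟨pt d, hd, ?_⟩
    ext p
    change eval₂RingHom P.hom d (C p) = 0 ↔ P.hom p = 0
    simp
  · rintro ⟨q, hq, hqP⟩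
    simp only [ConstructibleSetData.toSet, Set.mem_iUnion] at hq ⊢
    obtain ⟨B, hB, hqg, hqf⟩ := hq
    have hχ (g : Coord[X]) : algebraMap _ q.asIdeal.ResidueField g = 0 ↔ g ∈ q.asIdeal :=
      Ideal.algebraMap_residueField_eq_zero
    obtain ⟨d, hdf, hdg⟩ := exists_eval₂_ne_zero P.hom
      (algebraMap Coord[X] q.asIdeal.ResidueField) (by
        ext p
        rw [RingHom.mem_ker, RingHom.comp_apply, hχ]
        exact (PrimeSpectrum.ext_iff.1 hqP ▸ Iff.rfl : p ∈ (comap C q).asIdeal ↔ p ∈ P.prime.asIdeal))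
      B.f (by rw [ne_eq, hχ]; simpa using hqf)
    refine ⟨d, B, hB, ?_, ?_⟩
    · rintro _ ⟨i, rfl⟩
      exact hdg _ ((hχ _).2 (hqg ⟨i, rfl⟩))
    · simpa [pt] using hdf

end Constr

/-! ### Truth of formulas is constructible -/

/-- `F` is piecewise a quotient of polynomials, the pieces being constructible: constructible
conditions depending on numerator and denominator of `F` are constructible. -/
def PiecewiseRational (F : ∀ P : Pt, P.K) : Prop :=
  ∀ G : Coord → Coord → Pt → Prop, (∀ p q, Constr (G p q)) →
    ∃ H, Constr H ∧ ∀ P : Pt, ∃ p q : Coord,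
      P.hom q ≠ 0 ∧ F P * P.hom q = P.hom p ∧ (H P ↔ G p q P)

namespace PiecewiseRational

variable {F F' : ∀ P : Pt, P.K}

theorem of_hom (p : Coord) : PiecewiseRational fun P => P.hom p :=
  fun G hG => ⟨G p 1, hG p 1, fun P => ⟨p, 1, by simp, by simp, Iff.rfl⟩⟩

theorem neg (h : PiecewiseRational F) : PiecewiseRational fun P => - F P := fun G hG => by
  obtain ⟨H, hH, hP⟩ := h (fun p q => G (-p) q) fun p q => hG _ _
  refine ⟨H, hH, fun P => ?_⟩
  obtain ⟨p, q, hq, hF, hHG⟩ := hP P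
  exact ⟨-p, q, hq, by simp [hF], hHG⟩

theorem map₂ (h : PiecewiseRational F) (h' : PiecewiseRational F')
    (op : ∀ P : Pt, P.K → P.K → P.K) (num : Coord → Coord → Coord → Coord → Coord)
    (hop : ∀ (P : Pt) (x y : P.K) (p q p' q' : Coord), x * P.hom q = P.hom p →
      y * P.hom q' = P.hom p' → op P x y * P.hom (q * q') = P.hom (num p q p' q')) :
    PiecewiseRational fun P => op P (F P) (F' P) := fun G hG => by
  have h'' (p q : Coord) := h' (fun p' q' => G (num p q p' q') (q * q')) fun _ _ => hG _ _
  choose G' hG' hP' using h''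
  obtain ⟨H, hH, hP⟩ := h G' hG'
  refine ⟨H, hH, fun P => ?_⟩
  obtain ⟨p, q, hq, hF, hHG⟩ := hP P
  obtain ⟨p', q', hq', hF', hHG'⟩ := hP' p q P
  exact ⟨_, _, by simp [hq, hq'], hop P _ _ _ _ _ _ hF hF', hHG.trans hHG'⟩

theorem add (h : PiecewiseRational F) (h' : PiecewiseRational F') :
    PiecewiseRational fun P => F P + F' P :=
  h.map₂ h' (fun _ x y => x + y) (fun p q p' q' => p * q' + p' * q) fun P x y p q p' q' e e' => by
    simp only [map_add, map_mul, ← e, ← e']; ring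

theorem mul (h : PiecewiseRational F) (h' : PiecewiseRational F') :
    PiecewiseRational fun P => F P * F' P :=
  h.map₂ h' (fun _ x y => x * y) (fun p _ p' _ => p * p') fun P x y p q p' q' e e' => by
    simp only [map_mul, ← e, ← e']; ring

open Classical in
theorem inv (h : PiecewiseRational F) :
    PiecewiseRational fun P => if F P = 0 then P.c else (F P)⁻¹ := fun G hG => by
  obtain ⟨H, hH, hP⟩ := h
    (fun p q P => P.hom p = 0 ∧ G (MvPolynomial.X none) 1 P ∨ ¬ P.hom p = 0 ∧ G q p P)
    fun p q => ((Constr.hom_eq_zero p).and (hG _ _)).or ((Constr.hom_eq_zero p).not.and (hG _ _))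
  refine ⟨H, hH, fun P => ?_⟩
  obtain ⟨p, q, hq, hF, hHG⟩ := hP P
  by_cases hp : P.hom p = 0
  · have h0 : F P = 0 := by simpa [hp, hq] using hF
    exact ⟨MvPolynomial.X none, 1, by simp, by simp [h0, Pt.hom], by simpa [hp] using hHG⟩
  · have h0 : F P ≠ 0 := fun h0 => hp (by simp [← hF, h0])
    exact ⟨q, p, hp, by simp [h0, ← hF], by simpa [hp] using hHG⟩

theorem eval (t : Term acfSig) : PiecewiseRational fun P => eval P.interp P.a t := by
  induction t with
  | var n => simpa [ACFQE.eval, Pt.hom] using of_hom (MvPolynomial.X (some n))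
  | func f ts ih =>
    cases f with
    | plus => exact (ih (0 : Fin 2)).add (ih (1 : Fin 2))
    | times => exact (ih (0 : Fin 2)).mul (ih (1 : Fin 2))
    | neg => exact (ih (0 : Fin 1)).neg
    | inv => exact (ih (0 : Fin 1)).inv
    | zero =>
      have := of_hom 0
      simp only [map_zero] at this
      exact this
    | one =>
      have := of_hom 1
      simp only [map_one] at this
      exact this

theorem constr_eq (h : PiecewiseRational F) (h' : PiecewiseRational F') :
    Constr fun P => F P = F' P := by
  obtain ⟨H, hH, hP⟩ := (h.add h'.neg) (fun p _ P => P.hom p = 0)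
    fun p _ => Constr.hom_eq_zero p
  convert hH using 2 with P
  obtain ⟨p, q, hq, hF, hHG⟩ := hP P
  dsimp only at hF
  rw [hHG, ← hF, mul_eq_zero, or_iff_left hq, ← sub_eq_add_neg, sub_eq_zero]

end PiecewiseRational

theorem constr_holds (A : Formula acfSig) : Constr fun P => Holds P.interp P.a A := by
  induction A with
  | falsum => exact .const False
  | verum => exact .const True
  | equal t u => exact (PiecewiseRational.eval t).constr_eq (.eval u)
  | rel r _ => exact r.elim
  | and A B ihA ihB => exact ihA.and ihB
  | or A B ihA ihB => exact ihA.or ihB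
  | neg A ih => exact ih.not
  | imp A B ihA ihB => exact ihA.imp ihB
  | all x A ih =>
    have := (ih.not.ex x).not
    simp only [not_exists, not_not] at this
    exact this
  | ex x A ih => exact ih.ex x

/-! ### Constructible predicates are quantifier-free definable -/

theorem exists_term (p : Coord) : ∃ t : Term acfSig, ∀ P : Pt, eval P.interp P.a t = P.hom p := by
  induction p using MvPolynomial.induction_on with
  | C n =>
    induction n with
    | zero => exact ⟨ACF.c0, fun P => by simp [Pt.interp, eval_fieldInterp_c0]⟩
    | succ n ih =>
      obtain ⟨t, ht⟩ := ih
      refine ⟨ACF.add t ACF.c1, fun P => ?_⟩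
      rw [Pt.interp, eval_fieldInterp_add, eval_fieldInterp_c1, ← Pt.interp, ht]
      simp
    | pred n ih =>
      obtain ⟨t, ht⟩ := ih
      refine ⟨ACF.add t (ACF.minus ACF.c1), fun P => ?_⟩
      rw [Pt.interp, eval_fieldInterp_add, eval_fieldInterp_minus, eval_fieldInterp_c1,
        ← Pt.interp, ht]
      simp [sub_eq_add_neg]
  | add p q hp hq =>
    obtain ⟨t, ht⟩ := hp
    obtain ⟨u, hu⟩ := hq
    refine ⟨ACF.add t u, fun P => ?_⟩
    rw [Pt.interp, eval_fieldInterp_add, ← Pt.interp, ht, hu, map_add]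
  | mul_X p o hp =>
    obtain ⟨t, ht⟩ := hp
    refine ⟨ACF.mul t (o.elim (ACF.inv ACF.c0) ACF.v), fun P => ?_⟩
    rw [Pt.interp, eval_fieldInterp_mul, ← Pt.interp, ht, map_mul]
    congr 1
    cases o
    · simp [Pt.interp, eval_fieldInterp_inv_c0, Pt.hom]
    · simp [eval_v, Pt.hom]

/-- Predicates on points defined by a quantifier-free formula. -/
def QFDef (Q : Pt → Prop) : Prop :=
  ∃ B : Formula acfSig, B.QFree ∧ ∀ P, Holds P.interp P.a B ↔ Q P

namespace QFDef

variable {Q Q' : Pt → Prop}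

theorem and (h : QFDef Q) (h' : QFDef Q') : QFDef fun P => Q P ∧ Q' P := by
  obtain ⟨B, hB, hQ⟩ := h
  obtain ⟨B', hB', hQ'⟩ := h'
  exact ⟨.and B B', ⟨hB, hB'⟩, fun P => and_congr (hQ P) (hQ' P)⟩

theorem or (h : QFDef Q) (h' : QFDef Q') : QFDef fun P => Q P ∨ Q' P := by
  obtain ⟨B, hB, hQ⟩ := h
  obtain ⟨B', hB', hQ'⟩ := h'
  exact ⟨.or B B', ⟨hB, hB'⟩, fun P => or_congr (hQ P) (hQ' P)⟩

theorem not (h : QFDef Q) : QFDef fun P => ¬ Q P := by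
  obtain ⟨B, hB, hQ⟩ := h
  exact ⟨.neg B, hB, fun P => not_congr (hQ P)⟩

theorem hom_eq_zero (p : Coord) : QFDef fun P => P.hom p = 0 := by
  obtain ⟨t, ht⟩ := exists_term p
  refine ⟨.equal t ACF.c0, trivial, fun P => ?_⟩
  rw [Holds, ht]
  rfl

theorem exists_mem_finset {ι : Type*} (s : Finset ι) {Q : ι → Pt → Prop}
    (h : ∀ i ∈ s, QFDef (Q i)) : QFDef fun P => ∃ i ∈ s, Q i P := by
  classical
  induction s using Finset.induction_on with
  | empty => exact ⟨.falsum, trivial, fun P => by simp [Holds]⟩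
  | insert i s _ ih =>
    simp only [Finset.exists_mem_insert]
    exact (h i (Finset.mem_insert_self i s)).or
      (ih fun j hj => h j (Finset.mem_insert_of_mem hj))

theorem forall_fintype {ι : Type*} [Fintype ι] {Q : ι → Pt → Prop}
    (h : ∀ i, QFDef (Q i)) : QFDef fun P => ∀ i, Q i P := by
  simpa using (exists_mem_finset Finset.univ fun i _ => (h i).not).not

end QFDef

theorem Constr.qfDef {Q : Pt → Prop} (h : Constr Q) : QFDef Q := by
  obtain ⟨S, hS, hQ⟩ := h
  obtain ⟨T, rfl⟩ := exists_constructibleSetData_iff.2 hS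
  have : QFDef fun P => ∃ B ∈ T, (∀ i, P.hom (B.g i) = 0) ∧ ¬ P.hom B.f = 0 :=
    .exists_mem_finset T fun B _ =>
      (QFDef.forall_fintype fun i => .hom_eq_zero (B.g i)).and (QFDef.hom_eq_zero B.f).not
  convert this using 2 with P
  rw [hQ]
  simp [ConstructibleSetData.toSet, BasicConstructibleSetData.toSet, Pt.prime, mem_zeroLocus,
    Set.range_subset_iff, and_left_comm]

end ACFQE

/-- **Quantifier elimination for ACF over serial B-models**: over any class
`C` of serial `B`-models, every formula of the language of ACF is
ACF-equivalent over `C` to a quantifier-free formula. -/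
theorem stmt_18 (C : BModel acfSig → Prop) (hC : ∀ M : BModel acfSig, C M → M.Serial)
    (A : Formula acfSig) :
    ∃ B : Formula acfSig, B.QFree ∧ Entails C ACF.theory (A.iff B) := by
  obtain ⟨B, hB, h⟩ := (ACFQE.constr_holds A).qfDef
  refine ⟨B, hB, fun M hM hT a => ?_⟩
  have hser := hC M hM
  obtain ⟨_, _, c, hI⟩ := ACFQE.exists_field_of_holds M.interpFunc a fun A hA a =>
    (ACFQE.truth_iff_holds hser A M.s a).1 (hT A hA a)
  have hAB : ACFQE.Holds M.interpFunc a B ↔ ACFQE.Holds M.interpFunc a A := by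
    rw [hI]
    exact h ⟨M.D, c, a⟩
  refine ⟨fun w₁ w₂ _ h => ?_, fun w₁ w₂ _ h => ?_⟩ <;>
  · rw [ACFQE.truth_iff_holds hser] at h ⊢
    simpa only [hAB] using h
end
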